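/- arXiv:1409.2090 — 4 statements merged into one kernel-verified Lean document; each statement's English description precedes it below -/
import Mathlib

section
/- For every integer k ≥ 0 and every real w > 1, e^{−w} ∑_{i=0}^{k−1} w^i / i! ≤ e·(k+2)! / w³, where the sum is 0 when k = 0. -/
/-- A partial sum of the exponential series times `w ^ 3` is at most `(k + 2)! * exp w`. -/
theorem sum_pow_div_factorial_mul_pow_three_le (k : ℕ) {w : ℝ} (hw : 0 ≤ w) :
    (∑ i ∈ Finset.range k, w ^ i / (Nat.factorial i)) * w ^ 3
      ≤ Nat.factorial (k + 2) * Real.exp w := by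
  have term_le : ∀ i ∈ Finset.range k, w ^ i / (Nat.factorial i) * w ^ 3
      ≤ Nat.factorial (k + 2) * (w ^ (3 + i) / (Nat.factorial (3 + i))) := by
    intro i hi
    have hik : 3 + i ≤ k + 2 := by
      have := Finset.mem_range.mp hi
      omega
    have hfac : ((3 + i).factorial : ℝ) ≤ (k + 2).factorial := by
      exact_mod_cast Nat.factorial_le hik
    have hi_one : (1 : ℝ) ≤ i.factorial := by
      exact_mod_cast Nat.succ_le_of_lt i.factorial_pos
    calc w ^ i / i.factorial * w ^ 3 = w ^ (3 + i) / i.factorial := by ring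
      _ ≤ w ^ (3 + i) := div_le_self (by positivity) hi_one
      _ ≤ (k + 2).factorial * (w ^ (3 + i) / (3 + i).factorial) := by
        rw [← mul_div_assoc, le_div_iff₀ (by positivity), mul_comm]
        gcongr
  calc (∑ i ∈ Finset.range k, w ^ i / (Nat.factorial i)) * w ^ 3
      ≤ Nat.factorial (k + 2) *
          ∑ i ∈ Finset.range k, w ^ (3 + i) / (Nat.factorial (3 + i)) := by
        rw [Finset.sum_mul, Finset.mul_sum]
        exact Finset.sum_le_sum term_le
    _ ≤ Nat.factorial (k + 2) *
          ∑ i ∈ Finset.range (3 + k), w ^ i / (Nat.factorial i) := by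
        rw [Finset.sum_range_add]
        gcongr
        exact le_add_of_nonneg_left (Finset.sum_nonneg fun i _ => by positivity)
    _ ≤ Nat.factorial (k + 2) * Real.exp w := by
        gcongr
        exact Real.sum_le_exp_of_nonneg hw _

/-- **Key quantitative bound in Lemma 1** of Scornet, "On the asymptotics of random
forests": for every integer `k ≥ 0` and every real `w > 1`,
`e^{−w} ∑_{i=0}^{k−1} wⁱ/i! ≤ e (k+2)! / w³` (the sum being `0` when `k = 0`). -/
theorem exp_neg_mul_sum_pow_div_factorial_le
    (k : ℕ) (w : ℝ) (hw : 1 < w) :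
    Real.exp (-w) * ∑ i ∈ Finset.range k, w ^ i / (Nat.factorial i)
      ≤ Real.exp 1 * (Nat.factorial (k + 2)) / w ^ 3 := by
  have hw0 : 0 < w := by linarith
  rw [le_div_iff₀ (by positivity), mul_assoc]
  calc Real.exp (-w) * ((∑ i ∈ Finset.range k, w ^ i / (Nat.factorial i)) * w ^ 3)
      ≤ Real.exp (-w) * (Nat.factorial (k + 2) * Real.exp w) := by
        exact mul_le_mul_of_nonneg_left
          (sum_pow_div_factorial_mul_pow_three_le k hw0.le) (Real.exp_pos _).le
    _ = Nat.factorial (k + 2) := by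
        rw [mul_left_comm, ← Real.exp_add, neg_add_cancel, Real.exp_zero, mul_one]
    _ ≤ Real.exp 1 * Nat.factorial (k + 2) :=
        le_mul_of_one_le_left (by positivity) (Real.one_le_exp zero_le_one)
end

section
/- Let k ≥ 0 and d ≥ 1 be integers and ε > 0. For every t ∈ (0,1) such that −ln t > 1 and −ln t ≥ (8·d·e·(k+2)! / ε²)^{1/3}, one has d · t · ∑_{j=0}^{k−1} (−ln t)^j / j! ≤ ε² / 8, where the sum is 0 when k = 0. -/
/-- Truncated exponential sums at `x ≥ 1` are controlled by their top power. -/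
theorem mul_sum_range_pow_div_factorial_le {x : ℝ} (hx : 1 ≤ x) (k : ℕ) :
    x * ∑ j ∈ Finset.range k, x ^ j / (Nat.factorial j) ≤ Real.exp 1 * x ^ k := by
  have hpow : ∀ j ∈ Finset.range k,
      x * (x ^ j / (Nat.factorial j)) ≤ x ^ k * (1 ^ j / (Nat.factorial j)) := by
    intro j hj
    have h : x ^ (j + 1) ≤ x ^ k := pow_le_pow_right₀ hx (Finset.mem_range.mp hj)
    calc x * (x ^ j / (Nat.factorial j)) = x ^ (j + 1) * (1 ^ j / (Nat.factorial j)) := by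
          rw [one_pow]; ring
      _ ≤ x ^ k * (1 ^ j / (Nat.factorial j)) := by gcongr
  calc x * ∑ j ∈ Finset.range k, x ^ j / (Nat.factorial j)
      ≤ x ^ k * ∑ j ∈ Finset.range k, (1 : ℝ) ^ j / (Nat.factorial j) := by
        rw [Finset.mul_sum, Finset.mul_sum]
        exact Finset.sum_le_sum hpow
    _ ≤ x ^ k * Real.exp 1 := by
        gcongr
        exact Real.sum_le_exp_of_nonneg zero_le_one k
    _ = Real.exp 1 * x ^ k := mul_comm _ _

/-- For `0 < t ≤ 1` one has `(-log t) ^ n * t ≤ n!`. -/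
theorem neg_log_pow_mul_le_factorial {t : ℝ} (ht : 0 < t) (ht1 : t ≤ 1) (n : ℕ) :
    (-Real.log t) ^ n * t ≤ Nat.factorial n := by
  have h := Real.pow_div_factorial_le_exp (-Real.log t)
    (neg_nonneg.mpr (Real.log_nonpos ht.le ht1)) n
  rw [Real.exp_neg, Real.exp_log ht, div_le_iff₀ (by positivity)] at h
  calc (-Real.log t) ^ n * t ≤ t⁻¹ * Nat.factorial n * t := by gcongr
    _ = Nat.factorial n := by field_simp

/-- **Quantitative core of Lemma 1** of Scornet, "On the asymptotics of random forests"
(grid step of uniform forests): for integers `k ≥ 0`, `d ≥ 1` and `ε > 0`, if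
`t ∈ (0,1)` satisfies `−ln t > 1` and `−ln t ≥ (8 d e (k+2)! / ε²)^{1/3}`, then
`d t ∑_{j=0}^{k−1} (−ln t)^j / j! ≤ ε²/8` (the sum being `0` when `k = 0`). -/
theorem uniform_forest_grid_step_bound
    (k d : ℕ) (hd : 1 ≤ d) (ε : ℝ) (hε : 0 < ε)
    (t : ℝ) (ht : t ∈ Set.Ioo (0 : ℝ) 1)
    (hlog1 : 1 < -Real.log t)
    (hlog2 : ((8 * d * Real.exp 1 * (Nat.factorial (k + 2)) / ε ^ 2) ^ ((1 : ℝ) / 3))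
        ≤ -Real.log t) :
    (d : ℝ) * t * ∑ j ∈ Finset.range k, (-Real.log t) ^ j / (Nat.factorial j)
      ≤ ε ^ 2 / 8 := by
  have hfac := neg_log_pow_mul_le_factorial ht.1 ht.2.le (k + 2)
  have hsum := mul_sum_range_pow_div_factorial_le hlog1.le k
  set L := -Real.log t
  set S := ∑ j ∈ Finset.range k, L ^ j / (Nat.factorial j)
  have ht0 : 0 < t := ht.1
  have hL : 0 < L := one_pos.trans hlog1
  have hS : 0 ≤ S := Finset.sum_nonneg fun j _ => by positivity
  have hcube : 8 * d * Real.exp 1 * (Nat.factorial (k + 2)) ≤ L ^ 3 * ε ^ 2 := by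
    rw [← div_le_iff₀ (by positivity), ← Real.rpow_natCast L 3]
    rw [one_div, Real.rpow_inv_le_iff_of_pos (by positivity) hL.le (by norm_num)] at hlog2
    exact_mod_cast hlog2
  refine le_of_mul_le_mul_left ?_ (pow_pos hL (k + 3))
  calc L ^ (k + 3) * (d * t * S) = d * ((L ^ (k + 2) * t) * (L * S)) := by ring
    _ ≤ d * (Nat.factorial (k + 2) * (Real.exp 1 * L ^ k)) := by gcongr
    _ = L ^ k * (8 * d * Real.exp 1 * Nat.factorial (k + 2)) / 8 := by ring
    _ ≤ L ^ k * (L ^ 3 * ε ^ 2) / 8 := by gcongr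
    _ = L ^ (k + 3) * (ε ^ 2 / 8) := by ring
end

section
/- Let a < b be reals, let 0 < c' ≤ C' be reals, and let g : ℝ → ℝ be integrable on [a,b] with c' ≤ g(u) ≤ C' for all u ∈ [a,b]. Let q' ∈ (0,1) and let z ∈ [a,b] satisfy ∫_a^z g(u) du = q' ∫_a^b g(u) du. Then (z − a)/(b − a) ≤ q'C' / (q'C' + (1 − q')c') and (b − z)/(b − a) ≤ (1 − q')C' / (q'c' + (1 − q')C'). -/
open MeasureTheory intervalIntegral

/-- An interval-integrable function bounded below by `m` and above by `M` on `[x, y]` has integral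
between `m * (y - x)` and `M * (y - x)`. -/
theorem intervalIntegral_mem_Icc_of_forall_mem_Icc {f : ℝ → ℝ} {x y m M : ℝ} (hxy : x ≤ y)
    (hf : IntervalIntegrable f volume x y) (hm : ∀ u ∈ Set.Icc x y, m ≤ f u)
    (hM : ∀ u ∈ Set.Icc x y, f u ≤ M) :
    ∫ u in x..y, f u ∈ Set.Icc (m * (y - x)) (M * (y - x)) := by
  constructor
  · simpa [mul_comm] using
      intervalIntegral.integral_mono_on hxy intervalIntegrable_const hf hm
  · simpa [mul_comm] using
      intervalIntegral.integral_mono_on hxy hf intervalIntegrable_const hM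

/-- **Geometric step in the proof of Lemma 3** of Scornet, "On the asymptotics of random
forests": if `g` is integrable on `[a,b]` with `c' ≤ g ≤ C'` there (`0 < c' ≤ C'`), and
`z ∈ [a,b]` is a theoretical `q'`-quantile, i.e. `∫_a^z g = q' ∫_a^b g` with `q' ∈ (0,1)`,
then both sides of the split cell are proper fractions of the original side:
`(z−a)/(b−a) ≤ q'C'/(q'C' + (1−q')c')` and `(b−z)/(b−a) ≤ (1−q')C'/(q'c' + (1−q')C')`. -/
theorem quantile_split_ratio_bounds
    (a b c' C' : ℝ) (hab : a < b) (hc' : 0 < c') (hcC : c' ≤ C')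
    (g : ℝ → ℝ)
    (hint : IntervalIntegrable g volume a b)
    (hlb : ∀ u ∈ Set.Icc a b, c' ≤ g u)
    (hub : ∀ u ∈ Set.Icc a b, g u ≤ C')
    (q' : ℝ) (hq' : q' ∈ Set.Ioo (0 : ℝ) 1)
    (z : ℝ) (hz : z ∈ Set.Icc a b)
    (hquant : ∫ u in a..z, g u = q' * ∫ u in a..b, g u) :
    (z - a) / (b - a) ≤ q' * C' / (q' * C' + (1 - q') * c')
      ∧ (b - z) / (b - a) ≤ (1 - q') * C' / (q' * c' + (1 - q') * C') := by
  obtain ⟨hq0, hq1⟩ := hq'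
  obtain ⟨haz, hzb⟩ := hz
  have hC' : 0 < C' := hc'.trans_le hcC
  have hq1' : 0 < 1 - q' := sub_pos.2 hq1
  have hint_left : IntervalIntegrable g volume a z :=
    hint.mono_set (Set.uIcc_subset_uIcc_left (Set.mem_uIcc_of_le haz hzb))
  have hint_right : IntervalIntegrable g volume z b :=
    hint.mono_set (Set.uIcc_subset_uIcc_right (Set.mem_uIcc_of_le haz hzb))
  obtain ⟨hL, hL'⟩ := intervalIntegral_mem_Icc_of_forall_mem_Icc haz hint_left
    (fun u hu ↦ hlb u ⟨hu.1, hu.2.trans hzb⟩) (fun u hu ↦ hub u ⟨hu.1, hu.2.trans hzb⟩)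
  obtain ⟨hR, hR'⟩ := intervalIntegral_mem_Icc_of_forall_mem_Icc hzb hint_right
    (fun u hu ↦ hlb u ⟨haz.trans hu.1, hu.2⟩) (fun u hu ↦ hub u ⟨haz.trans hu.1, hu.2⟩)
  rw [← integral_add_adjacent_intervals hint_left hint_right] at hquant
  constructor
  · rw [div_le_div_iff₀ (sub_pos.2 hab) (by positivity)]
    linarith [mul_le_mul_of_nonneg_left hL hq1'.le, mul_le_mul_of_nonneg_left hR' hq0.le]
  · rw [div_le_div_iff₀ (sub_pos.2 hab) (by positivity)]
    linarith [mul_le_mul_of_nonneg_left hL' hq1'.le, mul_le_mul_of_nonneg_left hR hq0.le]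
end

section
/- Let q ∈ [1/2, 1), let q' ∈ [1 − q, q], and let 0 < c ≤ C be reals. Then max( q'C / (q'C + (1 − q')c), (1 − q')C / (q'c + (1 − q')C) ) ≤ qC / ((1 − q)(c + C)). -/
/-- **Uniform bound on the shrinkage factors of `q`-quantile splits** (used in the proof
of Lemma 3 of Scornet, "On the asymptotics of random forests"): for `q ∈ [1/2, 1)`,
`q' ∈ [1−q, q]` and `0 < c ≤ C`,
`max(q'C/(q'C + (1−q')c), (1−q')C/(q'c + (1−q')C)) ≤ qC/((1−q)(c+C))`. -/
theorem quantile_shrinkage_factor_bound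
    (q q' c C : ℝ) (hq : q ∈ Set.Ico (1 / 2 : ℝ) 1)
    (hq' : q' ∈ Set.Icc (1 - q) q) (hc : 0 < c) (hcC : c ≤ C) :
    max (q' * C / (q' * C + (1 - q') * c)) ((1 - q') * C / (q' * c + (1 - q') * C))
      ≤ q * C / ((1 - q) * (c + C)) := by
  obtain ⟨hq_half, hq_one⟩ := hq
  obtain ⟨hq'_lower, hq'_upper⟩ := hq'
  have hC : 0 < C := hc.trans_le hcC
  have hp : 0 < 1 - q := sub_pos.mpr hq_one
  apply max_le
  · apply div_le_div₀
    · positivity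
    · gcongr
    · positivity
    · nlinarith
  · apply div_le_div₀
    · positivity
    · gcongr
      linarith
    · positivity
    · nlinarith
end
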